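/- arXiv:2504.21057 — 2 statements merged into one kernel-verified Lean document; each statement's English description precedes it below -/
import Mathlib

section
/- Let f, g : S → ℂ satisfy the integral Kannappan-sine addition law ∫_S f(xσ(y)t) dμ(t) = f(x)g(y) + f(y)g(x) for all x, y ∈ S, with ∫_S f(t) dμ(t) = 0 and f, g linearly independent over ℂ. If ∫_S ∫_S g(σ(t)s) dμ(s)dμ(t) ≠ 0, then ∫_S ∫_S f(σ(t)s) dμ(s)dμ(t) = 0. -/
/-- Integral of `h` against a finitely supported complex measure `μ` on `S`:
`∫_S h(t) dμ(t) = Σ_t μ(t) h(t)`. -/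
noncomputable def mint {S : Type*} (μ : S →₀ ℂ) (h : S → ℂ) : ℂ :=
  μ.sum fun t c => c * h t

/-- The Kannappan-sine addition law with respect to an element `m` of a semigroup with involutive
automorphism `s`. -/
theorem kannappan_sine_vanishing {A : Type*} [Semigroup A] (s : A → A)
    (hmul : ∀ x y : A, s (x * y) = s x * s y) (hinv : ∀ x : A, s (s x) = x)
    (m : A) (f g : A → ℂ)
    (hf : ∀ x y : A, f (x * s y * m) = f x * g y + f y * g x) (hfm : f m = 0)
    (hli : ∀ a b : ℂ, (∀ x : A, a * f x + b * g x = 0) → a = 0 ∧ b = 0)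
    (hg : g (s m * m) ≠ 0) : f (s m * m) = 0 := by
  have hswap (x z y : A) :
      f (x * z) * g y + f y * g (x * z) = f x * g (s z * y) + f (s z * y) * g x := by
    rw [← hf, ← hf]
    simp only [hmul, hinv, mul_assoc]
  obtain ⟨x₀, hx₀⟩ : ∃ x, f x ≠ 0 := by
    by_contra! h
    exact one_ne_zero (hli 1 0 fun x => by simp [h]).1
  have hright (y : A) : f (y * s m * m) = f y * g m := by rw [hf, hfm]; ring
  have htranslate (y : A) : f (y * m) * g m = f (s m * m) * g y + g (s m * m) * f y := by
    have h := hf y (s m * m)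
    have h' := hright (y * m)
    simp only [hmul, hinv, mul_assoc] at h h' ⊢
    linear_combination h - h'
  have hc : g m ≠ 0 := by
    intro h0
    refine hg (hli (g (s m * m)) (f (s m * m)) fun x => ?_).1
    linear_combination h0 * f (x * m) - htranslate x
  have hgright (w : A) : g (w * s m * m) = g m * g w := by
    have h1 := hswap x₀ (s w * m) m
    have h2 := hf x₀ w
    have h3 := hright w
    simp only [hmul, hinv, mul_assoc] at h1 h2 h3 ⊢
    apply mul_left_cancel₀ hx₀
    linear_combination g m * h2 - h1 - g x₀ * h3 + g (x₀ * (s w * m)) * hfm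
  have hff : f (m * m) = f (s m * m) := by
    apply mul_right_cancel₀ hc
    rw [htranslate, hfm]; ring
  have hff' : f (m * s m) = f (s m * m) := by
    have h := hswap m (s m) m
    simp only [hinv] at h
    apply mul_right_cancel₀ hc
    linear_combination h + hff * g m - g (m * s m) * hfm + g (m * m) * hfm
  have hgg : g (m * s m) = g (s m * m) := by
    have h1 := htranslate (x₀ * s m * m)
    have h2 := hf x₀ (m * s m)
    rw [hgright, hright] at h1
    simp only [hmul, hinv, mul_assoc] at h1 h2
    apply mul_left_cancel₀ (mul_ne_zero hx₀ hc)
    linear_combination h1 - g m * h2 - g m * g x₀ * hff'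
  have hprod := htranslate (m * s m)
  rw [hf m m, hfm, hgg, hff'] at hprod
  have h : f (s m * m) * g (s m * m) = 0 := by linear_combination -hprod / 2
  exact (mul_eq_zero.mp h).resolve_right hg

section mint

variable {S : Type*}

theorem mint_zero_measure (h : S → ℂ) : mint 0 h = 0 := Finsupp.sum_zero_index

theorem mint_add_measure (μ ν : S →₀ ℂ) (h : S → ℂ) : mint (μ + ν) h = mint μ h + mint ν h :=
  Finsupp.sum_add_index' (by simp) (by intros; ring)

theorem mint_single (x : S) (c : ℂ) (h : S → ℂ) : mint (Finsupp.single x c) h = c * h x :=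
  Finsupp.sum_single_index (by simp)

theorem mint_add (μ : S →₀ ℂ) (h k : S → ℂ) :
    mint μ (fun t => h t + k t) = mint μ h + mint μ k := by
  simp only [mint, mul_add, Finsupp.sum_add]

theorem mint_mul_const (μ : S →₀ ℂ) (h : S → ℂ) (c : ℂ) :
    mint μ (fun t => h t * c) = mint μ h * c := by
  simp only [mint, Finsupp.sum, Finset.sum_mul, mul_assoc]

theorem mint_const_mul (μ : S →₀ ℂ) (h : S → ℂ) (c : ℂ) :
    mint μ (fun t => c * h t) = c * mint μ h := by
  simp only [mul_comm c, mint_mul_const]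

theorem mint_mapDomain (σ : S → S) (μ : S →₀ ℂ) (h : S → ℂ) :
    mint (μ.mapDomain σ) h = mint μ (fun t => h (σ t)) :=
  Finsupp.sum_mapDomain_index (by simp) (by intros; ring)

/-- Integration against a convolution product is iterated integration. -/
theorem mint_coeff_mul [Mul S] (p q : MonoidAlgebra ℂ S) (h : S → ℂ) :
    mint (p * q).coeff h = mint p.coeff (fun t => mint q.coeff (fun s => h (t * s))) := by
  induction p using MonoidAlgebra.induction_linear with
  | zero => simp [mint_zero_measure]
  | add p p' hp hp' => simp [add_mul, mint_add_measure, hp, hp']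
  | single x a =>
    induction q using MonoidAlgebra.induction_linear with
    | zero => simp [mint_zero_measure, mint_single]
    | add q q' hq hq' =>
      simp only [MonoidAlgebra.coeff_single, mint_single] at hq hq' ⊢
      simp [mul_add, mint_add_measure, hq, hq']
    | single y b =>
      simp only [MonoidAlgebra.single_mul_single, MonoidAlgebra.coeff_single, mint_single, mul_assoc]

end mint

theorem stmt_15 {S : Type*} [Semigroup S] (σ : S → S)
    (hσmul : ∀ x y : S, σ (x * y) = σ x * σ y) (hσinv : ∀ x : S, σ (σ x) = x)
    (μ : S →₀ ℂ) (f g : S → ℂ)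
    (hf : ∀ x y : S, mint μ (fun t => f (x * σ y * t)) = f x * g y + f y * g x)
    (hf0 : mint μ f = 0)
    (hli : ∀ a b : ℂ, (∀ x : S, a * f x + b * g x = 0) → a = 0 ∧ b = 0)
    (hg0 : mint μ (fun t => mint μ (fun s => g (σ t * s))) ≠ 0) :
    mint μ (fun t => mint μ (fun s => f (σ t * s))) = 0 := by
  let s : MonoidAlgebra ℂ S → MonoidAlgebra ℂ S := MonoidAlgebra.mapDomain σ
  have hs (p : MonoidAlgebra ℂ S) (h : S → ℂ) :
      mint (s p).coeff h = mint p.coeff (fun t => h (σ t)) := mint_mapDomain σ p.coeff h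
  have key := kannappan_sine_vanishing s
    (MonoidAlgebra.mapDomain_mul (⟨σ, hσmul⟩ : S →ₙ* S))
    (fun p => by
      induction p using MonoidAlgebra.induction_linear with
      | zero => simp [s]
      | add p q hp hq => simp only [s, MonoidAlgebra.mapDomain_add] at hp hq ⊢; rw [hp, hq]
      | single x a => simp [s, hσinv])
    (MonoidAlgebra.ofCoeff μ) (fun p => mint p.coeff f) (fun p => mint p.coeff g)
    (fun p q => by
      simp only [mint_coeff_mul, hs, hf, mint_add, mint_mul_const, mint_const_mul])
    hf0
    (fun a b hab => hli a b fun x => by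
      simpa [mint_single] using hab (MonoidAlgebra.single x 1))
  simp only [mint_coeff_mul, hs] at key
  exact key hg0
end

section
/- Let χ be an exponential on S with χ∘σ = χ and ∫_S χ(t) dμ(t) ≠ 0, and let φ : S → ℂ be a nonzero function satisfying φ(xy) = φ(x)χ(y) + χ(x)φ(y) for all x, y ∈ S, with φ∘σ = φ and ∫_S φ(t) dμ(t) = 0. Then f := φ and g := (∫_S χ(t) dμ(t))·χ satisfy ∫_S f(xσ(y)t) dμ(t) = f(x)g(y) + f(y)g(x) for all x, y ∈ S. -/
/-- The integral against a finitely supported measure is linear. -/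
theorem mint_linear_combination {S : Type*} (μ : S →₀ ℂ) (a b : ℂ) (h k : S → ℂ) :
    mint μ (fun t => a * h t + b * k t) = a * mint μ h + b * mint μ k := by
  simp only [mint, Finsupp.sum, Finset.mul_sum, ← Finset.sum_add_distrib]
  exact Finset.sum_congr rfl fun t _ => by ring

theorem stmt_19 {S : Type*} [Semigroup S] (σ : S → S)
    (hσmul : ∀ x y : S, σ (x * y) = σ x * σ y) (hσinv : ∀ x : S, σ (σ x) = x)
    (μ : S →₀ ℂ)
    (χ : S → ℂ) (hχmul : ∀ x y : S, χ (x * y) = χ x * χ y) (hχ0 : χ ≠ 0)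
    (hχσ : ∀ x : S, χ (σ x) = χ x) (hχint : mint μ χ ≠ 0)
    (φ : S → ℂ) (hφ0 : φ ≠ 0)
    (hφadd : ∀ x y : S, φ (x * y) = φ x * χ y + χ x * φ y)
    (hφσ : ∀ x : S, φ (σ x) = φ x) (hφint : mint μ φ = 0)
    (f g : S → ℂ)
    (hfdef : f = φ) (hgdef : g = fun x => mint μ χ * χ x) :
    ∀ x y : S, mint μ (fun t => f (x * σ y * t)) = f x * g y + f y * g x := by
  intro x y
  subst hfdef hgdef
  have h : (fun t => f (x * σ y * t)) =
      fun t => f (x * σ y) * χ t + χ x * χ y * f t := by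
    funext t
    rw [hφadd, hχmul, hχσ]
  rw [h, mint_linear_combination, hφint, hφadd, hχσ, hφσ]
  ring
end
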